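/- arXiv:1301.5667 — 3 statements merged into one kernel-verified Lean document; each statement's English description precedes it below -/
import Mathlib

section
/- The orbit of D under the automorphism group of the Witt algebra coincides with the set of nilpotent elements outside g_0; that is, {φ(D) : φ a Lie algebra automorphism of g over k} = (g \ g_0) ∩ N. In particular, every nilpotent element x ∈ N with x ∉ g_0 is of the form φ(D) for some Lie algebra automorphism φ of g, and conversely φ(D) ∈ N and φ(D) ∉ g_0 for every Lie algebra automorphism φ of g. -/
open Polynomial

set_option synthInstance.maxHeartbeats 1000000
set_option maxHeartbeats 1000000

/-- The truncated polynomial algebra `A = k[X]/(X^p)`. -/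
noncomputable abbrev WittA (k : Type*) [Field k] (p : ℕ) : Type _ :=
  k[X] ⧸ Ideal.span ({X ^ p} : Set k[X])

/-- The coset of `X` in `A = k[X]/(X^p)`. -/
noncomputable abbrev WittX (k : Type*) [Field k] (p : ℕ) : WittA k p :=
  Ideal.Quotient.mk (Ideal.span ({X ^ p} : Set k[X])) X



namespace WittProof

section abstractPart

variable {k A : Type*} [Field k] [CommRing A] [Algebra k A]

/-- Iterated brackets of derivations agree with iterated commutators of endomorphisms. -/
lemma bracket_iter_coe (y z : Derivation k A A) (n : ℕ) :
    (((fun w : Derivation k A A => ⁅y, w⁆)^[n] z : Derivation k A A) : A →ₗ[k] A) =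
      ((LinearMap.mulLeft k (y : A →ₗ[k] A) - LinearMap.mulRight k (y : A →ₗ[k] A)) ^ n)
        (z : A →ₗ[k] A) := by
  induction n with
  | zero => simp
  | succ n ih =>
    rw [Function.iterate_succ_apply', pow_succ', Module.End.mul_apply, ← ih]
    ext a
    simp only [Derivation.coeFn_coe, Derivation.commutator_apply]
    rfl

lemma bracket_iter_p {p : ℕ} (hp : p.Prime) [CharP k p] [Nontrivial A]
    (y z : Derivation k A A) :
    (((fun w : Derivation k A A => ⁅y, w⁆)^[p] z : Derivation k A A) : A →ₗ[k] A) =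
      (y : A →ₗ[k] A) ^ p * (z : A →ₗ[k] A) - (z : A →ₗ[k] A) * (y : A →ₗ[k] A) ^ p := by
  have : Fact p.Prime := ⟨hp⟩
  have : CharP (Module.End k (A →ₗ[k] A)) p :=
    charP_of_injective_algebraMap (algebraMap k (Module.End k (A →ₗ[k] A))).injective p
  have hc : Commute (LinearMap.mulLeft k (y : A →ₗ[k] A)) (LinearMap.mulRight k (y : A →ₗ[k] A)) :=
    LinearMap.commute_mulLeft_right _ _
  rw [bracket_iter_coe]
  have h := sub_pow_char_of_commute (R := Module.End k (A →ₗ[k] A)) p hc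
  rw [LinearMap.pow_mulLeft, LinearMap.pow_mulRight] at h
  exact LinearMap.congr_fun h (z : A →ₗ[k] A)

lemma bracket_iter_equiv (φ : Derivation k A A ≃ₗ⁅k⁆ Derivation k A A) (d z : Derivation k A A)
    (n : ℕ) :
    (fun w : Derivation k A A => ⁅φ d, w⁆)^[n] (φ z) =
      φ ((fun w : Derivation k A A => ⁅d, w⁆)^[n] z) := by
  induction n with
  | zero => simp
  | succ n ih =>
    rw [Function.iterate_succ_apply', Function.iterate_succ_apply', ih, LieEquiv.map_lie]

/-- `[f D, h D] = (f h' - h f') D`. -/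
lemma bracket_iter_smul (D : Derivation k A A) (f h : A) (n : ℕ) :
    (fun w : Derivation k A A => ⁅f • D, w⁆)^[n] (h • D) =
      ((fun g : A => f * D g - g * D f)^[n] h) • D := by
  induction n with
  | zero => simp
  | succ n ih =>
    rw [Function.iterate_succ_apply', Function.iterate_succ_apply', ih]
    ext a
    simp [Derivation.commutator_apply]
    ring

lemma natCast_ne {p n : ℕ} [CharP k p] (h0 : 0 < n) (hn : n < p) : (n : k) ≠ 0 := by
  rw [Ne, CharP.cast_eq_zero_iff k p]
  exact fun h => absurd (Nat.le_of_dvd h0 h) (by omega)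

lemma factorial_ne {p n : ℕ} (hp : p.Prime) [CharP k p] (hn : n < p) :
    (n.factorial : k) ≠ 0 := by
  rw [Ne, CharP.cast_eq_zero_iff k p, hp.dvd_factorial]
  omega

/-- `T = y^p` commuting with all derivations and killing `1` vanishes. -/
lemma comm_all_zero {p : ℕ} [CharP k p] (x : A) (D : Derivation k A A) (hD : D x = 1)
    (hxp : x ^ p = 0) (hgen : ∀ a : A, ∃ q : k[X], a = aeval x q)
    (T : A →ₗ[k] A) (hT1 : T 1 = 0)
    (hTD : ∀ a, T (D a) = D (T a)) (hTXD : ∀ a, T (x * D a) = x * D (T a)) : T = 0 := by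
  have key : ∀ n, T (x ^ n) = 0 := by
    intro n
    induction n with
    | zero => simpa using hT1
    | succ n ih =>
      by_cases hn : n + 1 < p
      · have h1 := hTXD (x ^ (n + 1))
        rw [← hTD] at h1
        have e1 : D (x ^ (n + 1)) = ((n + 1 : ℕ) : k) • x ^ n := by
          rw [Derivation.leibniz_pow, hD, Nat.cast_smul_eq_nsmul]; simp
        rw [e1, mul_smul_comm, map_smul, map_smul, ih, smul_zero, mul_zero, ← pow_succ'] at h1
        exact (smul_eq_zero.mp h1).resolve_left (natCast_ne (p := p) (by omega) hn)
      · have : x ^ (n + 1) = 0 := pow_eq_zero_of_le (by omega) hxp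
        rw [this, map_zero]
  ext a
  obtain ⟨q, rfl⟩ := hgen a
  rw [aeval_eq_sum_range, map_sum]
  simp [key]

lemma nilpotent_of_orbit {p : ℕ} (hp : p.Prime) [CharP k p] [Nontrivial A] (x : A)
    (D : Derivation k A A) (hD : D x = 1)
    (hxp : x ^ p = 0) (hgen : ∀ a : A, ∃ q : k[X], a = aeval x q)
    (hDp : (D : A →ₗ[k] A) ^ p = 0)
    (φ : Derivation k A A ≃ₗ⁅k⁆ Derivation k A A) :
    (φ D : A →ₗ[k] A) ^ p = 0 := by
  have hcomm : ∀ z : Derivation k A A,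
      (φ D : A →ₗ[k] A) ^ p * (z : A →ₗ[k] A) = (z : A →ₗ[k] A) * (φ D : A →ₗ[k] A) ^ p := by
    intro z
    rw [← sub_eq_zero, ← bracket_iter_p hp]
    obtain ⟨z, rfl⟩ : ∃ z', φ z' = z := φ.surjective z
    rw [bracket_iter_equiv]
    have h0 : (fun w : Derivation k A A => ⁅D, w⁆)^[p] z = 0 := by
      have := bracket_iter_p hp D z
      rw [hDp, zero_mul, mul_zero, sub_zero] at this
      ext a
      exact LinearMap.congr_fun this a
    rw [h0, map_zero]
    rfl
  refine comm_all_zero (p := p) x D hD hxp hgen _ ?_ ?_ ?_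
  · obtain ⟨m, rfl⟩ : ∃ m, p = m + 1 := ⟨p - 1, by have := hp.pos; omega⟩
    rw [pow_succ, Module.End.mul_apply]
    simp
  · intro a
    exact LinearMap.congr_fun (hcomm D) a
  · intro a
    exact LinearMap.congr_fun (hcomm (x • D)) a

lemma der_eq (x : A) (D : Derivation k A A) (hD : D x = 1)
    (hgen : ∀ a : A, ∃ q : k[X], a = aeval x q) (d : Derivation k A A) : d = d x • D := by
  ext a
  obtain ⟨q, rfl⟩ := hgen a
  rw [Derivation.smul_apply, Derivation.map_aeval, Derivation.map_aeval, hD]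
  simp [mul_comm]

/-- Elements of `g_1` satisfy `(ad y)^(p-1) = 0`. -/
lemma ad_g1 {p : ℕ} (hp3 : 3 < p) (x : A) (D : Derivation k A A) (hD : D x = 1)
    (hxp : x ^ p = 0) (ε : A → k)
    (hε : ∀ a : A, ∃ b, a = algebraMap k A (ε a) + x * b) (g h : A) :
    (fun w : A => (x ^ 2 * g) * D w - w * D (x ^ 2 * g))^[p - 1] h = 0 := by
  set L : A → A := fun w : A => (x ^ 2 * g) * D w - w * D (x ^ 2 * g) with hL
  have hL1 : ∀ j, ∀ w, ∃ v, L (x ^ (j + 1) * w) = x ^ (j + 2) * v := by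
    intro j w
    refine ⟨(j + 1) * g * w + x * g * D w - w * (2 * g + x * D g), ?_⟩
    simp only [hL, Derivation.leibniz, Derivation.leibniz_pow, hD, smul_eq_mul, nsmul_eq_mul]
    push_cast
    simp
    ring
  have hLn : ∀ n j w, ∃ v, L^[n] (x ^ (j + 1) * w) = x ^ (j + 1 + n) * v := by
    intro n
    induction n with
    | zero => intro j w; exact ⟨w, rfl⟩
    | succ n ih =>
      intro j w
      obtain ⟨v, hv⟩ := hL1 j w
      obtain ⟨v', hv'⟩ := ih (j + 1) v
      refine ⟨v', ?_⟩
      rw [Function.iterate_succ_apply, hv, hv']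
      ring
  have hadd : ∀ a b, L (a + b) = L a + L b := by
    intro a b
    simp only [hL, map_add]; ring
  have hLadd : ∀ n a b, L^[n] (a + b) = L^[n] a + L^[n] b := by
    intro n
    induction n with
    | zero => intro a b; rfl
    | succ n ih => intro a b; simp only [Function.iterate_succ_apply, hadd, ih]
  have hconst : ∀ c : k, ∃ v, L^[3] (algebraMap k A c) = x ^ 4 * v := by
    intro c
    have e1 : L (algebraMap k A c) = - algebraMap k A c * D (x ^ 2 * g) := by
      simp [hL]
    refine ⟨-algebraMap k A c * (g ^ 2 * (6 * D g + 6 * x * D (D g) + x ^ 2 * D (D (D g))) +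
      (2 * g + x * D g) * ((2 * g + x * D g) * D g - 2 * g * (3 * D g + x * D (D g)))), ?_⟩
    have e0 : D (x ^ 2 * g) = 2 * x * g + x ^ 2 * D g := by
      simp [hD]; ring
    have e2 : D (D (x ^ 2 * g)) = 2 * g + 4 * x * D g + x ^ 2 * D (D g) := by
      have h2 : D (2 : A) = 0 := by exact_mod_cast Derivation.map_natCast D 2
      rw [e0]; simp [hD, h2]; ring
    have e3 : D (D (D (x ^ 2 * g))) = 6 * D g + 6 * x * D (D g) + x ^ 2 * D (D (D g)) := by
      have h2 : D (2 : A) = 0 := by exact_mod_cast Derivation.map_natCast D 2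
      have h4 : D (4 : A) = 0 := by exact_mod_cast Derivation.map_natCast D 4
      rw [e2]; simp [hD, h2, h4]; ring
    simp only [Function.iterate_succ_apply, Function.iterate_zero, id]
    rw [e1]
    generalize hF : x ^ 2 * g = F at *
    simp only [hL, Derivation.leibniz, smul_eq_mul, map_sub, map_neg, Derivation.map_algebraMap,
      mul_zero, neg_zero, add_zero]
    rw [e3, e2, e0, ← hF]
    ring
  obtain ⟨b, hb⟩ := hε h
  rw [hb, hLadd]
  have t1 : L^[p - 1] (x * b) = 0 := by
    obtain ⟨v, hv⟩ := hLn (p - 1) 0 b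
    rw [zero_add, pow_one] at hv
    rw [hv, show 1 + (p - 1) = p by omega, hxp, zero_mul]
  have t2 : L^[p - 1] (algebraMap k A (ε h)) = 0 := by
    obtain ⟨v, hv⟩ := hconst (ε h)
    obtain ⟨v', hv'⟩ := hLn (p - 4) 3 v
    rw [show p - 1 = (p - 4) + 3 by omega, Function.iterate_add_apply, hv, hv',
      show 3 + 1 + (p - 4) = p by omega, hxp, zero_mul]
  rw [t1, t2, add_zero]

lemma pow_zero_of_iter (D : Derivation k A A) (n : ℕ) (h : ∀ a, D^[n] a = 0) :
    (D : A →ₗ[k] A) ^ n = 0 := by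
  ext a
  rw [Module.End.pow_apply]
  exact h a

lemma D_iter (x : A) (D : Derivation k A A) (hD : D x = 1) (n : ℕ) :
    (fun w : A => 1 * D w - w * D 1)^[n] (x ^ n) = algebraMap k A (n.factorial : k) := by
  have aux : ∀ n (c : k), (fun w : A => 1 * D w - w * D 1)^[n] (c • x ^ n) =
      algebraMap k A (c * n.factorial) := by
    intro n
    induction n with
    | zero => intro c; simp [Algebra.smul_def]
    | succ n ih =>
      intro c
      rw [Function.iterate_succ_apply]
      have : (1 * D (c • x ^ (n + 1)) - (c • x ^ (n + 1)) * D 1) = (c * ((n + 1 : ℕ) : k)) • x ^ n := by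
        rw [Derivation.map_smul, Derivation.leibniz_pow, hD, mul_smul, Nat.cast_smul_eq_nsmul]; simp
      rw [this, ih, Nat.factorial_succ]
      push_cast
      ring_nf
  simpa using aux n 1

/-- A nilpotent element of `g_0` lies in `g_1`. -/
lemma g0_nil_g1 {p : ℕ} (x : A) (D : Derivation k A A) (hD : D x = 1)
    (ε : A →ₐ[k] k) (hεx : ε x = 0)
    (hε : ∀ a : A, ∃ b, a = algebraMap k A (ε a) + x * b) (c : A)
    (hnil : (((x * c) • D : Derivation k A A) : A →ₗ[k] A) ^ p = 0) : ∃ g, x * c = x ^ 2 * g := by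
  have key : ∀ n, ∃ e, ((((x * c) • D : Derivation k A A) : A →ₗ[k] A) ^ n) x = x * e ∧
      ε e = ε c ^ n := by
    intro n
    induction n with
    | zero => exact ⟨1, by simp, by simp⟩
    | succ n ih =>
      obtain ⟨e, he, he'⟩ := ih
      refine ⟨c * (e + x * D e), ?_, ?_⟩
      · rw [pow_succ', Module.End.mul_apply, he]
        simp [hD]
        ring
      · simp [hεx, he', pow_succ']
  obtain ⟨e, he, he'⟩ := key p
  rw [hnil, LinearMap.zero_apply] at he
  have h1 : D (x * e) = 0 := by rw [← he, map_zero]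
  have h2 := congrArg ε h1
  simp [hεx, hD, he'] at h2
  obtain ⟨b, hb⟩ := hε c
  rw [h2.1, map_zero, zero_add] at hb
  exact ⟨b, by rw [hb]; ring⟩

lemma orbit_subset {p : ℕ} (hp : p.Prime) (hp3 : 3 < p) [CharP k p] [Nontrivial A] (x : A)
    (D : Derivation k A A) (hD : D x = 1)
    (hxp : x ^ p = 0) (hgen : ∀ a : A, ∃ q : k[X], a = aeval x q)
    (hDp : (D : A →ₗ[k] A) ^ p = 0)
    (ε : A →ₐ[k] k) (hεx : ε x = 0)
    (hε : ∀ a : A, ∃ b, a = algebraMap k A (ε a) + x * b)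
    (φ : Derivation k A A ≃ₗ⁅k⁆ Derivation k A A) :
    (φ D) x ∉ Ideal.span {x} ∧ (φ D : A →ₗ[k] A) ^ p = 0 := by
  have hnil := nilpotent_of_orbit hp x D hD hxp hgen hDp φ
  refine ⟨?_, hnil⟩
  intro hmem
  obtain ⟨c, hc⟩ := Ideal.mem_span_singleton'.mp hmem
  have e1 : φ D = (x * c) • D := by
    rw [mul_comm, hc]; exact der_eq x D hD hgen _
  rw [e1] at hnil
  obtain ⟨g, hg⟩ := g0_nil_g1 x D hD ε hεx hε c hnil
  rw [hg] at e1
  have h1 := bracket_iter_equiv φ D (x ^ (p - 1) • D) (p - 1)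
  rw [e1, der_eq x D hD hgen (φ (x ^ (p - 1) • D)), bracket_iter_smul, ad_g1 hp3 x D hD hxp ε hε,
    zero_smul] at h1
  have h2 := bracket_iter_smul D 1 (x ^ (p - 1)) (p - 1)
  rw [one_smul, D_iter x D hD] at h2
  rw [h2] at h1
  replace h1 := φ.injective (h1.symm.trans (map_zero φ).symm)
  have h3 := congrArg ε (DFunLike.congr_fun h1 x)
  simp [hD] at h3
  exact factorial_ne (k := k) hp (show p - 1 < p by omega) h3

/-- Conjugation by an algebra automorphism. -/
noncomputable def conjDer (σ : A ≃ₐ[k] A) (d : Derivation k A A) : Derivation k A A :=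
  Derivation.mk' (σ.toLinearMap ∘ₗ (d : A →ₗ[k] A) ∘ₗ σ.symm.toLinearMap) (by
    intro a b
    simp)

lemma conjDer_apply (σ : A ≃ₐ[k] A) (d : Derivation k A A) (a : A) :
    conjDer σ d a = σ (d (σ.symm a)) := rfl

/-- Conjugation as a Lie algebra automorphism. -/
noncomputable def conjLie (σ : A ≃ₐ[k] A) : Derivation k A A ≃ₗ⁅k⁆ Derivation k A A where
  toFun := conjDer σ
  map_add' d e := by ext a; simp [conjDer_apply]
  map_smul' c d := by ext a; simp [conjDer_apply]
  map_lie' := by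
    intro d e
    ext a
    simp [conjDer_apply, Derivation.commutator_apply]
  invFun := conjDer σ.symm
  left_inv d := by ext a; simp [conjDer_apply]
  right_inv d := by ext a; simp [conjDer_apply]

lemma exists_primitive {p : ℕ} (hp : p.Prime) [CharP k p] (x : A)
    (D : Derivation k A A) (hD : D x = 1) (hxp : x ^ p = 0)
    (ε : A →ₐ[k] k) (hεx : ε x = 0)
    (hε : ∀ a : A, ∃ b, a = algebraMap k A (ε a) + x * b) (u : A) (hu : ε u ≠ 0)
    (hnil : ((u • D : Derivation k A A) : A →ₗ[k] A) ^ p = 0) :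
    ∃ y, u * D y = 1 := by
  set d : Derivation k A A := u • D with hd
  have key : ∀ n a, ε (((d : A →ₗ[k] A) ^ n) (x ^ n * a)) = n.factorial * ε u ^ n * ε a := by
    intro n
    induction n with
    | zero => intro a; simp
    | succ n ih =>
      intro a
      have : d (x ^ (n + 1) * a) = x ^ n * (u * ((n + 1) * a + x * D a)) := by
        simp [hd, hD]; ring
      rw [pow_succ, Module.End.mul_apply, Derivation.coeFn_coe, this, ih, Nat.factorial_succ]
      simp [hεx]
      ring
  obtain ⟨m, rfl⟩ : ∃ m, p = m + 2 := ⟨p - 2, by have := hp.two_le; omega⟩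
  set z := ((d : A →ₗ[k] A) ^ m) (x ^ (m + 1)) with hz
  have hw : ε (d z) ≠ 0 := by
    have := key (m + 1) 1
    rw [pow_succ', Module.End.mul_apply, mul_one, ← hz, Derivation.coeFn_coe] at this
    rw [this]
    simp only [map_one, mul_one]
    exact mul_ne_zero (factorial_ne hp (by omega)) (pow_ne_zero _ hu)
  have hdw : d (d z) = 0 := by
    have := LinearMap.congr_fun hnil (x ^ (m + 1))
    rw [pow_succ', pow_succ', Module.End.mul_apply, Module.End.mul_apply, ← hz] at this
    exact this
  have hunit : IsUnit (d z) := by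
    obtain ⟨b, hb⟩ := hε (d z)
    rw [hb]
    refine IsNilpotent.isUnit_add_left_of_commute ⟨m + 2, ?_⟩ ?_ (Commute.all _ _)
    · rw [mul_pow, hxp, zero_mul]
    · exact (IsUnit.mk0 _ hw).map _
  obtain ⟨v, hv⟩ := hunit.exists_right_inv
  have hdv : d v = 0 := by
    have h := Derivation.leibniz_of_mul_eq_one d (a := v) (b := d z) (by rw [mul_comm]; exact hv)
    rw [h, hdw, smul_zero]
  refine ⟨v * z, ?_⟩
  have : d (v * z) = 1 := by
    rw [Derivation.leibniz, hdv, smul_zero, add_zero, smul_eq_mul, mul_comm]; exact hv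
  exact this

lemma orbit_superset {p : ℕ} (hp : p.Prime) [CharP k p] [Module.Finite k A] (x : A)
    (D : Derivation k A A) (hD : D x = 1)
    (hxp : x ^ p = 0) (hgen : ∀ a : A, ∃ q : k[X], a = aeval x q)
    (ε : A →ₐ[k] k) (hεx : ε x = 0)
    (hε : ∀ a : A, ∃ b, a = algebraMap k A (ε a) + x * b)
    (hz : ∀ a : A, (∀ n < p, ε (D^[n] a) = 0) → a = 0)
    (hlift : ∀ y : A, y ^ p = 0 → ∃ σ : A →ₐ[k] A, σ x = y)
    (d : Derivation k A A) (hd : d x ∉ Ideal.span {x}) (hnil : (d : A →ₗ[k] A) ^ p = 0) :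
    ∃ φ : Derivation k A A ≃ₗ⁅k⁆ Derivation k A A, φ D = d := by
  have hdD := der_eq x D hD hgen d
  have hu : ε (d x) ≠ 0 := by
    intro h
    obtain ⟨b, hb⟩ := hε (d x)
    rw [h, map_zero, zero_add] at hb
    exact hd (Ideal.mem_span_singleton.mpr ⟨b, hb⟩)
  obtain ⟨y0, hy0⟩ := exists_primitive hp x D hD hxp ε hεx hε (d x) hu (by rw [← hdD]; exact hnil)
  obtain ⟨b, hb⟩ := hε y0
  have hdy : d (x * b) = 1 := by
    have h1 : d y0 = 1 := by rw [hdD]; exact hy0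
    rw [hb] at h1
    simpa using h1
  obtain ⟨σ, hσ⟩ := hlift (x * b) (by rw [mul_pow, hxp, zero_mul])
  have hσq : ∀ q : k[X], σ (aeval x q) = aeval (x * b) q := by
    intro q; rw [← hσ, aeval_algHom_apply]
  have hint : ∀ a, d (σ a) = σ (D a) := by
    intro a
    obtain ⟨q, rfl⟩ := hgen a
    rw [hσq, Derivation.map_aeval, Derivation.map_aeval, hdy, hD]
    simp [hσq]
  have hεσ : ∀ a, ε (σ a) = ε a := by
    intro a
    obtain ⟨q, rfl⟩ := hgen a
    rw [hσq, ← aeval_algHom_apply, ← aeval_algHom_apply]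
    simp [hεx]
  have hinj : Function.Injective σ := by
    rw [injective_iff_map_eq_zero]
    intro a ha
    apply hz
    have h : ∀ n, σ (D^[n] a) = 0 := by
      intro n
      induction n with
      | zero => exact ha
      | succ n ih => rw [Function.iterate_succ_apply', ← hint, ih, map_zero]
    intro n _
    rw [← hεσ, h, map_zero]
  have hsurj : Function.Surjective σ :=
    (LinearMap.injective_iff_surjective (f := σ.toLinearMap)).mp hinj
  let τ : A ≃ₐ[k] A := AlgEquiv.ofBijective σ ⟨hinj, hsurj⟩
  refine ⟨conjLie τ, ?_⟩
  ext a
  change τ (D (τ.symm a)) = d a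
  change σ (D (τ.symm a)) = d a
  rw [← hint]
  congr 1
  exact τ.apply_symm_apply a

end abstractPart

end WittProof

open WittProof in
/-- The orbit of `D` under the automorphism group of the Witt algebra `g = Der_k(A)` coincides
with the set of nilpotent elements outside `g_0`:
`{φ(D) : φ ∈ Aut(g)} = (g \ g_0) ∩ N`. -/
theorem witt_orbit_of_D_eq_nilpotent_outside_g0 (p : ℕ) (hp : p.Prime) (hp3 : 3 < p)
    (k : Type*) [Field k] [IsAlgClosed k] [CharP k p]
    (D : Derivation k (WittA k p) (WittA k p)) (hD : D (WittX k p) = 1) :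
    {y : Derivation k (WittA k p) (WittA k p) |
        ∃ φ : Derivation k (WittA k p) (WittA k p) ≃ₗ⁅k⁆ Derivation k (WittA k p) (WittA k p),
          φ D = y} =
      {x : Derivation k (WittA k p) (WittA k p) |
        x (WittX k p) ∉ Ideal.span {WittX k p} ∧ x.toLinearMap ^ p = 0} := by
  have hmk : ∀ q : k[X], aeval (WittX k p) q = Ideal.Quotient.mk _ q := by
    intro q
    have := aeval_algHom_apply (Ideal.Quotient.mkₐ k (Ideal.span ({X ^ p} : Set k[X]))) X q
    rw [aeval_X_left_apply] at this
    exact this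
  have hgen : ∀ a : WittA k p, ∃ q : k[X], a = aeval (WittX k p) q := by
    intro a
    obtain ⟨q, rfl⟩ := Ideal.Quotient.mk_surjective a
    exact ⟨q, (hmk q).symm⟩
  have hxp : (WittX k p) ^ p = 0 := by
    rw [← map_pow, Ideal.Quotient.eq_zero_iff_mem]
    exact Ideal.subset_span rfl
  have : Module.Finite k (WittA k p) := (monic_X_pow (R := k) p).finite_quotient
  have hkill : ∀ {B : Type _} [CommRing B] [Algebra k B] (y : B), y ^ p = 0 →
      ∀ a ∈ Ideal.span ({X ^ p} : Set k[X]), aeval y a = 0 := by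
    intro B _ _ y hy a ha
    obtain ⟨c, rfl⟩ := Ideal.mem_span_singleton.mp ha
    simp [hy]
  let ε : WittA k p →ₐ[k] k := Ideal.Quotient.liftₐ _ (aeval (0 : k))
    (by
      intro a ha
      obtain ⟨c, rfl⟩ := Ideal.mem_span_singleton.mp ha
      simp [hp.ne_zero])
  have hεq : ∀ q : k[X], ε (aeval (WittX k p) q) = q.coeff 0 := by
    intro q
    rw [hmk]
    change aeval (0 : k) q = _
    simp [coeff_zero_eq_eval_zero, aeval_def]
  have hεx : ε (WittX k p) = 0 := by
    have := hεq X
    simpa using this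
  have : Nontrivial (WittA k p) := ε.toRingHom.domain_nontrivial
  have hε : ∀ a : WittA k p, ∃ b, a = algebraMap k _ (ε a) + WittX k p * b := by
    intro a
    obtain ⟨q, rfl⟩ := hgen a
    refine ⟨aeval (WittX k p) q.divX, ?_⟩
    rw [hεq]
    conv_lhs => rw [← divX_mul_X_add q]
    simp
    ring
  have hDq : ∀ n (q : k[X]), D^[n] (aeval (WittX k p) q) = aeval (WittX k p) (derivative^[n] q) := by
    intro n
    induction n with
    | zero => intro q; rfl
    | succ n ih =>
      intro q
      rw [Function.iterate_succ_apply, Derivation.map_aeval, hD, smul_eq_mul, mul_one, ih,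
        Function.iterate_succ_apply]
  have hDp : (D : WittA k p →ₗ[k] WittA k p) ^ p = 0 := by
    refine pow_zero_of_iter D p fun a => ?_
    obtain ⟨q, rfl⟩ := hgen a
    rw [hDq, ← factorial_smul_hasseDeriv, LinearMap.smul_apply, ← Nat.cast_smul_eq_nsmul k,
      (CharP.cast_eq_zero_iff k p _).mpr (hp.dvd_factorial.mpr le_rfl), zero_smul, map_zero]
  have hz : ∀ a : WittA k p, (∀ n < p, ε (D^[n] a) = 0) → a = 0 := by
    intro a ha
    obtain ⟨q, rfl⟩ := hgen a
    rw [hmk, Ideal.Quotient.eq_zero_iff_mem, Ideal.mem_span_singleton, X_pow_dvd_iff]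
    intro n hn
    have := ha n hn
    rw [hDq, hεq, coeff_iterate_derivative, zero_add, Nat.descFactorial_self,
      ← Nat.cast_smul_eq_nsmul k, smul_eq_mul] at this
    exact (mul_eq_zero.mp this).resolve_left (factorial_ne hp hn)
  have hlift : ∀ y : WittA k p, y ^ p = 0 → ∃ σ : WittA k p →ₐ[k] WittA k p,
      σ (WittX k p) = y := by
    intro y hy
    refine ⟨Ideal.Quotient.liftₐ _ (aeval y) (hkill y hy), ?_⟩
    change aeval y X = y
    simp
  ext d
  constructor
  · rintro ⟨φ, rfl⟩
    exact orbit_subset hp hp3 (WittX k p) D hD hxp hgen hDp ε hεx hε φ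
  · rintro ⟨h1, h2⟩
    exact orbit_superset hp (WittX k p) D hD hxp hgen ε hεx hε hz hlift d h1 h2
end

section
/- The nilpotent variety of the Witt algebra decomposes as N = {φ(D) : φ a Lie algebra automorphism of g over k} ∪ g_1. -/
open Polynomial

set_option synthInstance.maxHeartbeats 1000000
set_option maxHeartbeats 1000000

namespace WittAux

section Generic
variable {k A : Type*} [Field k] [CommRing A] [Algebra k A]

/-- Conjugation of a derivation by an algebra automorphism. -/
noncomputable def conjDer (s : A ≃ₐ[k] A) (d : Derivation k A A) : Derivation k A A :=
  Derivation.mk' (s.toLinearMap ∘ₗ d.toLinearMap ∘ₗ s.symm.toLinearMap) (by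
    intro a b
    simp)

theorem conjDer_apply (s : A ≃ₐ[k] A) (d : Derivation k A A) (a : A) :
    conjDer s d a = s (d (s.symm a)) := rfl

/-- Conjugation as a Lie algebra automorphism. -/
noncomputable def conjLie (s : A ≃ₐ[k] A) : Derivation k A A ≃ₗ⁅k⁆ Derivation k A A where
  toFun := conjDer s
  map_add' x y := by ext a; simp [conjDer_apply]
  map_smul' c x := by ext a; simp [conjDer_apply]
  map_lie' := by
    intro x y
    ext a
    simp [conjDer_apply, Derivation.commutator_apply]
  invFun := conjDer s.symm
  left_inv x := by ext a; simp [conjDer_apply]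
  right_inv x := by ext a; simp [conjDer_apply]

theorem conjLie_apply (s : A ≃ₐ[k] A) (d : Derivation k A A) (a : A) :
    conjLie s d a = s (d (s.symm a)) := rfl

theorem ad_iter (x z : Derivation k A A) (n : ℕ) :
    ((fun w => ⁅x, w⁆)^[n] z).toLinearMap =
      ((LinearMap.mulLeft k (x.toLinearMap : Module.End k A) -
        LinearMap.mulRight k (x.toLinearMap : Module.End k A)) ^ n) z.toLinearMap := by
  induction n with
  | zero => simp
  | succ n ih =>
    rw [Function.iterate_succ_apply', pow_succ', Module.End.mul_apply, ← ih]
    rfl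

theorem ad_pow (p : ℕ) [Fact p.Prime] [CharP k p] [Nontrivial A] (x z : Derivation k A A) :
    ((fun w => ⁅x, w⁆)^[p] z).toLinearMap =
      (x.toLinearMap : Module.End k A) ^ p * (z.toLinearMap : Module.End k A) -
      (z.toLinearMap : Module.End k A) * (x.toLinearMap : Module.End k A) ^ p := by
  haveI : CharP (Module.End k (Module.End k A)) p := charP_of_injective_algebraMap
    (algebraMap k (Module.End k (Module.End k A))).injective p
  have hcomm : Commute (LinearMap.mulLeft k (x.toLinearMap : Module.End k A))
      (LinearMap.mulRight k (x.toLinearMap : Module.End k A)) :=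
    LinearMap.ext fun c => (mul_assoc (x.toLinearMap : Module.End k A) c
      (x.toLinearMap : Module.End k A)).symm
  have hc := sub_pow_char_of_commute (R := Module.End k (Module.End k A)) p hcomm
  rw [LinearMap.pow_mulLeft, LinearMap.pow_mulRight] at hc
  rw [ad_iter]
  exact congrArg (fun f => f (z.toLinearMap : Module.End k A)) hc

theorem iter_lie (φ : Derivation k A A ≃ₗ⁅k⁆ Derivation k A A) (x z : Derivation k A A) (n : ℕ) :
    φ ((fun w => ⁅x, w⁆)^[n] z) = (fun w => ⁅φ x, w⁆)^[n] (φ z) := by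
  induction n with
  | zero => simp
  | succ n ih =>
    rw [Function.iterate_succ_apply', Function.iterate_succ_apply', ← ih, LieEquiv.map_lie]

theorem image_pow (p : ℕ) [Fact p.Prime] [CharP k p] [Nontrivial A]
    (D : Derivation k A A) (X : A) (hD : D X = 1) (hDp : D.toLinearMap ^ p = 0)
    (φ : Derivation k A A ≃ₗ⁅k⁆ Derivation k A A) : (φ D).toLinearMap ^ p = 0 := by
  have h0 : ∀ z : Derivation k A A, (fun w : Derivation k A A => ⁅D, w⁆)^[p] z = 0 := by
    intro z
    have := ad_pow p D z
    ext a
    have h2 := congrArg (fun f => f a) this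
    simp only [hDp] at h2
    simpa using h2
  have hc : ∀ z : Derivation k A A, ∀ a,
      ((φ D).toLinearMap ^ p) (z a) = z (((φ D).toLinearMap ^ p) a) := by
    intro z a
    have h1 := iter_lie φ D (φ.symm z) p
    rw [h0, map_zero, LieEquiv.apply_symm_apply] at h1
    have h2 := ad_pow p (φ D) z
    rw [← h1] at h2
    have h3 := congrArg (fun f => f a) h2
    exact (sub_eq_zero.mp h3.symm)
  have h1 : ((φ D).toLinearMap ^ p) 1 = 0 := by
    obtain ⟨n, hn⟩ := Nat.exists_eq_succ_of_ne_zero (Fact.out : p.Prime).ne_zero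
    rw [hn, pow_succ, Module.End.mul_apply]
    simp
  have h2 := hc D X
  rw [hD, h1] at h2
  ext a
  have h3 := hc (a • D) X
  simp only [Derivation.smul_apply, hD, smul_eq_mul, mul_one, ← h2, mul_zero] at h3
  simpa using h3

/-- A derivation with constants as kernel, nilpotent on a nonconstant, hits `1`. -/
theorem exists_one (x : Derivation k A A) (hk : ∀ a, x a = 0 → ∃ c : k, a = algebraMap k A c)
    (X : A) (hX : x X ≠ 0) (p : ℕ) (hp : x.toLinearMap ^ p = 0) : ∃ y, x y = 1 := by
  classical
  have hex : ∃ n, (x.toLinearMap ^ n) X = 0 := ⟨p, by rw [hp]; rfl⟩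
  obtain ⟨n, hn, hmin⟩ : ∃ n, (x.toLinearMap ^ n) X = 0 ∧
      ∀ m < n, (x.toLinearMap ^ m) X ≠ 0 :=
    ⟨Nat.find hex, Nat.find_spec hex, fun m hm => Nat.find_min hex hm⟩
  match n, hn, hmin with
  | 0, hn, _ => exact absurd (by simp at hn; simp [hn]) hX
  | 1, hn, _ => exact absurd (by simpa using hn) hX
  | n + 2, hn, hmin =>
    rw [pow_succ', Module.End.mul_apply] at hn
    obtain ⟨c, hc⟩ := hk _ hn
    have hne := hmin (n+1) (by omega)
    have hc0 : c ≠ 0 := by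
      rintro rfl
      exact hne (by simpa using hc)
    rw [pow_succ', Module.End.mul_apply] at hc
    refine ⟨c⁻¹ • (x.toLinearMap ^ n) X, ?_⟩
    rw [Derivation.map_smul]
    change c⁻¹ • x.toLinearMap _ = 1
    rw [hc, Algebra.smul_def, ← map_mul, inv_mul_cancel₀ hc0, map_one]

theorem sigma_inj [Nontrivial A] (D x : Derivation k A A)
    (hk : ∀ a, D a = 0 → ∃ c : k, a = algebraMap k A c)
    (p : ℕ) (hp : D.toLinearMap ^ p = 0) (s : A →ₐ[k] A) (hs : ∀ a, x (s a) = s (D a)) :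
    Function.Injective s := by
  classical
  rw [injective_iff_map_eq_zero]
  have key : ∀ n, ∀ a, (D.toLinearMap ^ n) a = 0 → s a = 0 → a = 0 := by
    intro n
    induction n with
    | zero => intro a ha _; simpa using ha
    | succ n ih =>
      intro a ha hsa
      have h1 : D a = 0 := by
        apply ih
        · rw [pow_succ, Module.End.mul_apply] at ha
          exact ha
        · rw [← hs, hsa, map_zero]
      obtain ⟨c, rfl⟩ := hk a h1
      rw [AlgHom.commutes] at hsa
      exact hsa
  intro a ha
  exact key p a (by rw [hp]; rfl) ha

end Generic

section Spec
variable {k : Type*} [Field k] {p : ℕ}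

theorem mk_eq_zero (q : k[X]) :
    (Ideal.Quotient.mk (Ideal.span ({X ^ p} : Set k[X])) q = 0) ↔ ∀ d < p, q.coeff d = 0 := by
  rw [Ideal.Quotient.eq_zero_iff_mem, Ideal.mem_span_singleton, X_pow_dvd_iff]

theorem aeval_X (q : k[X]) :
    aeval (WittX k p) q = Ideal.Quotient.mk (Ideal.span ({X ^ p} : Set k[X])) q := by
  have := Polynomial.aeval_algHom_apply (Ideal.Quotient.mkₐ k (Ideal.span ({X ^ p} : Set k[X]))) X q
  rw [Polynomial.aeval_X_left_apply] at this
  exact this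

theorem der_mk (x : Derivation k (WittA k p) (WittA k p)) (q : k[X]) :
    x (Ideal.Quotient.mk (Ideal.span ({X ^ p} : Set k[X])) q) =
      Ideal.Quotient.mk (Ideal.span ({X ^ p} : Set k[X])) (derivative q) * x (WittX k p) := by
  rw [← aeval_X, Derivation.map_aeval, aeval_X, smul_eq_mul]

theorem algMap_eq (c : k) : algebraMap k (WittA k p) c =
    Ideal.Quotient.mk (Ideal.span ({X ^ p} : Set k[X])) (C c) := rfl

theorem ker_const [CharP k p] (x : Derivation k (WittA k p) (WittA k p)) (r : k[X])
    (hr : x (WittX k p) = Ideal.Quotient.mk (Ideal.span ({X ^ p} : Set k[X])) r)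
    (h0 : r.coeff 0 ≠ 0) (a : WittA k p) (ha : x a = 0) :
    ∃ c : k, a = algebraMap k (WittA k p) c := by
  obtain ⟨q, rfl⟩ := Ideal.Quotient.mk_surjective a
  rw [der_mk, hr, ← map_mul, Ideal.Quotient.eq_zero_iff_mem, Ideal.mem_span_singleton] at ha
  have h1 : X ^ p ∣ derivative q := by
    refine Polynomial.prime_X.pow_dvd_of_dvd_mul_left (a := r) p ?_ (by rwa [mul_comm])
    rwa [X_dvd_iff]
  rw [X_pow_dvd_iff] at h1
  refine ⟨q.coeff 0, ?_⟩
  rw [algMap_eq, ← sub_eq_zero, ← map_sub, mk_eq_zero]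
  intro d hd
  cases d with
  | zero => simp
  | succ d =>
    have h2 := h1 d (by omega)
    rw [coeff_derivative] at h2
    have h3 : ((d : k) + 1) ≠ 0 := by
      intro h
      have h4 : ((d + 1 : ℕ) : k) = 0 := by push_cast; exact h
      rw [CharP.cast_eq_zero_iff k p] at h4
      exact absurd (Nat.le_of_dvd (by omega) h4) (by omega)
    have h5 := (mul_eq_zero.mp h2).resolve_right h3
    simp [h5, coeff_C]

theorem D_pow (hp : p.Prime) [CharP k p] (D : Derivation k (WittA k p) (WittA k p))
    (hD : D (WittX k p) = 1) : D.toLinearMap ^ p = 0 := by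
  have h : ∀ n (q : k[X]), (D.toLinearMap ^ n)
      (Ideal.Quotient.mk (Ideal.span ({X ^ p} : Set k[X])) q) =
      Ideal.Quotient.mk (Ideal.span ({X ^ p} : Set k[X])) (derivative^[n] q) := by
    intro n
    induction n with
    | zero => intro q; simp
    | succ n ih =>
      intro q
      rw [pow_succ', Module.End.mul_apply, ih, Function.iterate_succ_apply']
      have := der_mk D (derivative^[n] q)
      rw [hD, mul_one] at this
      exact this
  refine LinearMap.ext fun a => ?_
  obtain ⟨q, rfl⟩ := Ideal.Quotient.mk_surjective a
  rw [h, ← factorial_smul_hasseDeriv]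
  have : ((p.factorial : ℕ) : k[X]) = 0 := by
    rw [CharP.cast_eq_zero_iff k[X] p]
    exact Nat.dvd_factorial hp.pos le_rfl
  rw [LinearMap.smul_apply, nsmul_eq_mul, this, zero_mul, map_zero]
  rfl

theorem g1_pow (x : Derivation k (WittA k p) (WittA k p))
    (hx : x (WittX k p) ∈ Ideal.span {WittX k p ^ 2}) : x.toLinearMap ^ p = 0 := by
  obtain ⟨h, hh⟩ := Ideal.mem_span_singleton.mp hx
  have hall : ∀ a, ∃ b, x a = WittX k p ^ 2 * b := by
    intro a
    obtain ⟨q, rfl⟩ := Ideal.Quotient.mk_surjective a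
    exact ⟨_, by rw [der_mk, hh]; exact mul_left_comm _ _ _⟩
  have key : ∀ n a, ∃ b, (x.toLinearMap ^ n) a = WittX k p ^ n * b := by
    intro n
    induction n with
    | zero => intro a; exact ⟨a, by simp⟩
    | succ n ih =>
      intro a
      obtain ⟨b, hb⟩ := ih a
      obtain ⟨c, hc⟩ := hall b
      rw [pow_succ', Module.End.mul_apply, hb]
      cases n with
      | zero =>
        refine ⟨WittX k p * c, ?_⟩
        change x _ = _
        rw [pow_zero, one_mul, hc]; ring
      | succ n =>
        refine ⟨WittX k p * c + (n + 1 : ℕ) * h * b, ?_⟩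
        change x _ = _
        rw [Derivation.leibniz, hc, Derivation.leibniz_pow, hh]
        simp only [smul_eq_mul, nsmul_eq_mul, Nat.add_sub_cancel]
        ring
  refine LinearMap.ext fun a => ?_
  obtain ⟨b, hb⟩ := key p a
  have : WittX k p ^ p = 0 := by
    rw [← map_pow, Ideal.Quotient.eq_zero_iff_mem]
    exact Ideal.mem_span_singleton_self _
  rw [hb, this, zero_mul]
  rfl

theorem nil_coeff (hp : 1 < p) (x : Derivation k (WittA k p) (WittA k p))
    (hx : x.toLinearMap ^ p = 0) (r : k[X])
    (hr : x (WittX k p) = Ideal.Quotient.mk (Ideal.span ({X ^ p} : Set k[X])) r)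
    (h0 : r.coeff 0 = 0) : x (WittX k p) ∈ Ideal.span {WittX k p ^ 2} := by
  have key : ∀ n, ∃ q : k[X], (x.toLinearMap ^ n) (WittX k p) =
      Ideal.Quotient.mk (Ideal.span ({X ^ p} : Set k[X])) q ∧ q.coeff 0 = 0 ∧
      q.coeff 1 = r.coeff 1 ^ n := by
    intro n
    induction n with
    | zero => exact ⟨X, by simp⟩
    | succ n ih =>
      obtain ⟨q, hq, hq0, hq1⟩ := ih
      refine ⟨derivative q * r, ?_, ?_, ?_⟩
      · rw [pow_succ', Module.End.mul_apply, hq, map_mul, ← hr]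
        exact der_mk x q
      · simp [mul_coeff_zero, h0]
      · rw [mul_coeff_one, h0, coeff_derivative, hq1]
        simp [pow_succ]
  obtain ⟨q, hq, _, hq1⟩ := key p
  rw [hx] at hq
  have h1 := (mk_eq_zero q).mp hq.symm 1 hp
  rw [hq1] at h1
  have h2 : r.coeff 1 = 0 := by
    by_contra hne
    exact pow_ne_zero _ hne h1
  have h3 : X ^ 2 ∣ r := by
    rw [X_pow_dvd_iff]
    intro d hd
    interval_cases d <;> assumption
  rw [hr, Ideal.mem_span_singleton, ← map_pow]
  exact map_dvd _ h3

theorem exists_conj (hp : p.Prime) [CharP k p] (D : Derivation k (WittA k p) (WittA k p))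
    (hD : D (WittX k p) = 1) (x : Derivation k (WittA k p) (WittA k p))
    (hx : x.toLinearMap ^ p = 0) (r : k[X])
    (hr : x (WittX k p) = Ideal.Quotient.mk (Ideal.span ({X ^ p} : Set k[X])) r)
    (h0 : r.coeff 0 ≠ 0) :
    ∃ φ : Derivation k (WittA k p) (WittA k p) ≃ₗ⁅k⁆ Derivation k (WittA k p) (WittA k p),
      φ D = x := by
  have hne : x (WittX k p) ≠ 0 := by
    rw [hr]
    intro h
    exact h0 ((mk_eq_zero r).mp h 0 hp.pos)
  haveI : Nontrivial (WittA k p) := ⟨⟨_, _, hne⟩⟩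
  obtain ⟨y0, hy0⟩ := exists_one x (ker_const x r hr h0) (WittX k p) hne p hx
  obtain ⟨q0, rfl⟩ := Ideal.Quotient.mk_surjective y0
  obtain ⟨q, hy, hq0⟩ : ∃ q : k[X],
      x (Ideal.Quotient.mk (Ideal.span ({X ^ p} : Set k[X])) q) = 1 ∧ q.coeff 0 = 0 := by
    refine ⟨q0 - C (q0.coeff 0), ?_, by simp⟩
    rw [map_sub, map_sub, hy0, ← algMap_eq, Derivation.map_algebraMap, sub_zero]
  let I : Ideal k[X] := Ideal.span ({X ^ p} : Set k[X])
  let y : WittA k p := Ideal.Quotient.mk I q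
  have hyp : y ^ p = 0 := by
    change (Ideal.Quotient.mk I q) ^ p = 0
    rw [← map_pow, Ideal.Quotient.eq_zero_iff_mem, Ideal.mem_span_singleton]
    exact pow_dvd_pow_of_dvd (X_dvd_iff.mpr hq0) p
  let s : WittA k p →ₐ[k] WittA k p := Ideal.Quotient.liftₐ I (aeval y) (by
    intro a ha
    obtain ⟨b, rfl⟩ := Ideal.mem_span_singleton.mp ha
    rw [map_mul, map_pow, Polynomial.aeval_X, hyp, zero_mul])
  have hsmk : ∀ f : k[X], s (Ideal.Quotient.mk I f) = aeval y f := fun f => rfl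
  have hs : ∀ a, x (s a) = s (D a) := by
    intro a
    obtain ⟨f, rfl⟩ := Ideal.Quotient.mk_surjective a
    rw [der_mk, hD, mul_one, hsmk, hsmk, Derivation.map_aeval]
    change _ • x (Ideal.Quotient.mk I q) = _
    rw [hy, smul_eq_mul, mul_one]
  have hDk : ∀ a, D a = 0 → ∃ c : k, a = algebraMap k (WittA k p) c :=
    ker_const D 1 (by rw [hD, map_one]) (by simp)
  have hinj : Function.Injective s := sigma_inj D x hDk p (D_pow hp D hD) s hs
  haveI : Module.Finite k (WittA k p) :=
    Polynomial.Monic.finite_quotient (monic_X_pow p)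
  have hsurj : Function.Surjective s :=
    (LinearMap.injective_iff_surjective (f := s.toLinearMap)).mp hinj
  let e : WittA k p ≃ₐ[k] WittA k p := AlgEquiv.ofBijective s ⟨hinj, hsurj⟩
  refine ⟨conjLie e, ?_⟩
  refine Derivation.ext fun a => ?_
  rw [conjLie_apply]
  have h := hs (e.symm a)
  have h2 : s (e.symm a) = a := e.apply_symm_apply a
  rw [h2] at h
  exact h.symm

end Spec

end WittAux

/-- The nilpotent variety of the Witt algebra `g = Der_k(A)` decomposes as
`N = {φ(D) : φ ∈ Aut(g)} ∪ g_1`. -/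
theorem witt_nilpotent_variety_decomposition (p : ℕ) (hp : p.Prime) (hp3 : 3 < p)
    (k : Type*) [Field k] [IsAlgClosed k] [CharP k p]
    (D : Derivation k (WittA k p) (WittA k p)) (hD : D (WittX k p) = 1) :
    {x : Derivation k (WittA k p) (WittA k p) | x.toLinearMap ^ p = 0} =
      {y : Derivation k (WittA k p) (WittA k p) |
        ∃ φ : Derivation k (WittA k p) (WittA k p) ≃ₗ⁅k⁆ Derivation k (WittA k p) (WittA k p),
          φ D = y} ∪
      {x : Derivation k (WittA k p) (WittA k p) |
        x (WittX k p) ∈ Ideal.span {WittX k p ^ 2}} := by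
  haveI : Fact p.Prime := ⟨hp⟩
  haveI : Nontrivial (WittA k p) := by
    refine ⟨⟨1, 0, fun h => ?_⟩⟩
    rw [← map_one (Ideal.Quotient.mk (Ideal.span ({X ^ p} : Set k[X]))), WittAux.mk_eq_zero] at h
    simpa using h 0 hp.pos
  ext x
  simp only [Set.mem_union, Set.mem_setOf_eq]
  constructor
  · intro hx
    obtain ⟨r, hr⟩ := Ideal.Quotient.mk_surjective (x (WittX k p))
    by_cases h0 : r.coeff 0 = 0
    · exact Or.inr (WittAux.nil_coeff hp.one_lt x hx r hr.symm h0)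
    · exact Or.inl (WittAux.exists_conj hp D hD x hx r hr.symm h0)
  · rintro (⟨φ, rfl⟩ | h)
    · exact WittAux.image_pow p D (WittX k p) hD (WittAux.D_pow hp D hD) φ
    · exact WittAux.g1_pow x h
end

section
/- Let i be an integer with (p-1)/2 ≤ i ≤ p-2 and let x ∈ g_i \ g_{i+1}. Then the centralizer of x in g is z_g(x) = g_{p-1-i}. -/
open Polynomial

set_option synthInstance.maxHeartbeats 1000000
set_option maxHeartbeats 1000000

theorem wittX_pow_p (k : Type*) [Field k] (p : ℕ) : WittX k p ^ p = 0 := by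
  rw [WittX, ← map_pow, Ideal.Quotient.eq_zero_iff_mem]
  exact Ideal.mem_span_singleton_self _

theorem wittX_pow_eq_zero (k : Type*) [Field k] (p m : ℕ) (h : WittX k p ^ m = 0) : p ≤ m := by
  rw [WittX, ← map_pow, Ideal.Quotient.eq_zero_iff_mem, Ideal.mem_span_singleton] at h
  exact (pow_dvd_pow_iff X_ne_zero not_isUnit_X).1 h

theorem wittX_der (k : Type*) [Field k] (p : ℕ) (d : Derivation k (WittA k p) (WittA k p))
    (a : WittA k p) : ∃ c, d a = c * d (WittX k p) := by
  obtain ⟨q, rfl⟩ := Ideal.Quotient.mk_surjective a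
  have h : Ideal.Quotient.mk (Ideal.span ({X ^ p} : Set k[X])) q = aeval (WittX k p) q := by
    have := (Polynomial.aeval_algHom_apply
      (Ideal.Quotient.mkₐ k (Ideal.span ({X ^ p} : Set k[X]))) X q)
    simp only [aeval_X_left_apply] at this
    exact this.symm
  refine ⟨aeval (WittX k p) (derivative q), ?_⟩
  rw [h, Derivation.map_aeval, smul_eq_mul]

theorem wittX_unit_or (k : Type*) [Field k] (p : ℕ) (a : WittA k p) :
    IsUnit a ∨ WittX k p ∣ a := by
  obtain ⟨q, rfl⟩ := Ideal.Quotient.mk_surjective a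
  by_cases h : q.coeff 0 = 0
  · right
    exact map_dvd _ (X_dvd_iff.2 h)
  · left
    rw [← q.divX_mul_X_add, map_add, map_mul]
    apply IsNilpotent.isUnit_add_right_of_commute
    · exact Commute.isNilpotent_mul_left (Commute.all _ _) ⟨p, wittX_pow_p k p⟩
    · exact ((isUnit_iff_ne_zero.2 h).map C).map _
    · exact Commute.all _ _

theorem wittX_bracket (k : Type*) [Field k] (p : ℕ) (x y : Derivation k (WittA k p) (WittA k p))
    (i n : ℕ) (u v : WittA k p) (hx : x (WittX k p) = WittX k p ^ (i + 1) * u)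
    (hy : y (WittX k p) = WittX k p ^ n * v) :
    ∃ w, ⁅x, y⁆ (WittX k p) =
      WittX k p ^ (n + i) * (((n : WittA k p) - (i + 1)) * (u * v) + WittX k p * w) := by
  obtain ⟨a, ha⟩ := wittX_der k p x v
  obtain ⟨b, hb⟩ := wittX_der k p y u
  refine ⟨a * u - b * v, ?_⟩
  rw [Derivation.commutator_apply, hx, hy, Derivation.leibniz, Derivation.leibniz, ha, hb,
    Derivation.leibniz_pow, Derivation.leibniz_pow, hx, hy]
  simp only [smul_eq_mul, nsmul_eq_mul, Nat.add_sub_cancel]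
  generalize WittX k p = t
  cases n with
  | zero => push_cast; ring
  | succ n => simp only [Nat.add_sub_cancel]; push_cast; ring

/-- For `(p-1)/2 ≤ i ≤ p-2` and `x ∈ g_i \ g_{i+1}`, the centralizer of `x` in the Witt
algebra `g = Der_k(A)` is `z_g(x) = g_{p-1-i}`.
Here `g_j = {d : d(X) ∈ X^{j+1}·A}`, so `g_{p-1-i} = {d : d(X) ∈ X^{p-i}·A}`. -/
theorem witt_centralizer_large_filtration (p : ℕ) (hp : p.Prime) (hp3 : 3 < p)
    (k : Type*) [Field k] [IsAlgClosed k] [CharP k p]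
    (i : ℕ) (hi1 : p - 1 ≤ 2 * i) (hi2 : i ≤ p - 2)
    (x : Derivation k (WittA k p) (WittA k p))
    (hx1 : x (WittX k p) ∈ Ideal.span {WittX k p ^ (i + 1)})
    (hx2 : x (WittX k p) ∉ Ideal.span {WittX k p ^ (i + 2)}) :
    {y : Derivation k (WittA k p) (WittA k p) | ⁅x, y⁆ = 0} =
      {y : Derivation k (WittA k p) (WittA k p) |
        y (WittX k p) ∈ Ideal.span {WittX k p ^ (p - i)}} := by
  have hpi : i + 2 ≤ p := by omega
  obtain ⟨u, hu⟩ := Ideal.mem_span_singleton.1 hx1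
  have huu : IsUnit u := by
    refine (wittX_unit_or k p u).resolve_right fun ⟨c, hc⟩ => hx2 ?_
    rw [Ideal.mem_span_singleton]
    exact ⟨c, by rw [hu, hc]; ring⟩
  ext y
  simp only [Set.mem_setOf_eq, Ideal.mem_span_singleton]
  constructor
  · intro hxy
    have key : ∀ n, n ≤ p - i → WittX k p ^ n ∣ y (WittX k p) := by
      intro n
      induction n with
      | zero => intro _; simp
      | succ n ih =>
        intro hn
        obtain ⟨v, hv⟩ := ih (by omega)
        rcases wittX_unit_or k p v with hvu | ⟨c, hc⟩
        · exfalso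
          obtain ⟨w, hw⟩ := wittX_bracket k p x y i n u v hu hv
          rw [hxy, Derivation.zero_apply] at hw
          have hk : ((n : k) - (i + 1)) ≠ 0 := by
            intro h0
            have h1 : ((i + 1 - n : ℕ) : k) = 0 := by
              rw [Nat.cast_sub (by omega)]
              push_cast
              linear_combination -h0
            rw [CharP.cast_eq_zero_iff k p] at h1
            have := Nat.le_of_dvd (by omega) h1
            omega
          have hku : IsUnit ((n : WittA k p) - (i + 1)) := by
            have := (isUnit_iff_ne_zero.2 hk).map (algebraMap k (WittA k p))
            simpa using this
          have hun : IsUnit (((n : WittA k p) - (i + 1)) * (u * v) + WittX k p * w) := by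
            apply IsNilpotent.isUnit_add_left_of_commute
            · exact Commute.isNilpotent_mul_right (Commute.all _ _) ⟨p, wittX_pow_p k p⟩
            · exact hku.mul (huu.mul hvu)
            · exact Commute.all _ _
          have := wittX_pow_eq_zero k p _ ((hun.mul_left_eq_zero).1 hw.symm)
          omega
        · exact ⟨c, by rw [hv, hc]; ring⟩
    exact key _ le_rfl
  · rintro ⟨v, hv⟩
    obtain ⟨w, hw⟩ := wittX_bracket k p x y i _ u v hu hv
    rw [Nat.sub_add_cancel (by omega), wittX_pow_p, zero_mul] at hw
    ext a
    obtain ⟨c, hc⟩ := wittX_der k p ⁅x, y⁆ a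
    rw [hc, hw, mul_zero, Derivation.zero_apply]
end
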